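/- (Cutting a skew shape along a vertical line) Let λ ⊆ ν be partitions, θ = ν/λ, and let q ≥ 1 be a column index such that θ has at least one box in column q and at least one box in column q+1. Let θ_1 be the skew diagram consisting of the boxes of θ in columns 1,…,q (i.e. the skew diagram (min(ν_i,q))_i/(min(λ_i,q))_i) and θ_2 the skew diagram consisting of the boxes of θ in columns q+1, q+2, … (i.e. the skew diagram (max(ν_i−q,0))_i/(max(λ_i−q,0))_i, with zero parts removed). Set p = ν′_q − λ′_{q+1}, where ν′ and λ′ denote conjugate partitions, so that p is the number of rows from the top row of column q+1 of θ to the bottom row of column q of θ. Then G_θ(x_1,…,x_p) = G_{θ_1}(x_1,…,x_p)·G_{θ_2}(x_1,…,x_p) in ℤ[x_1,…,x_p]. -/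

import Mathlib

open MvPolynomial

/-- A set-valued tableau on an arbitrary finite set of boxes `(row, column)`.
Entries are `0`-based: the entry `i : ℕ` stands for the integer `i + 1`
(equivalently, for the variable `x_{i+1}`).  Rows weakly increase from left to
right and columns strictly increase from top to bottom, expressed via
horizontally and vertically adjacent boxes. -/
structure SVT (cells : Finset (ℕ × ℕ)) where
  entry : ℕ × ℕ → Finset ℕ
  nonempty_of_mem : ∀ c ∈ cells, (entry c).Nonempty
  eq_empty_of_not_mem : ∀ c, c ∉ cells → entry c = ∅
  row_weak : ∀ i j, (i, j) ∈ cells → (i, j + 1) ∈ cells →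
    ∀ a ∈ entry (i, j), ∀ b ∈ entry (i, j + 1), a ≤ b
  col_strict : ∀ i j, (i, j) ∈ cells → (i + 1, j) ∈ cells →
    ∀ a ∈ entry (i, j), ∀ b ∈ entry (i + 1, j), a < b

namespace SVT

variable {cells : Finset (ℕ × ℕ)}

/-- `|T|`: the total number of integers in the boxes of `T`. -/
def size (T : SVT cells) : ℕ := ∑ c ∈ cells, (T.entry c).card

/-- `T` has all its entries among `{1, …, m}` (i.e. `0`-based entries `< m`). -/
def Bounded (T : SVT cells) (m : ℕ) : Prop := ∀ c, ∀ x ∈ T.entry c, x < m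

/-- The monomial `x^T`, where the exponent of the variable `i` is the number of
boxes of `T` containing `i`. -/
noncomputable def monomial (T : SVT cells) : MvPolynomial ℕ ℤ :=
  ∏ c ∈ cells, ∏ i ∈ T.entry c, X i

/-- The column word of `T`: columns are read from left to right, each column
from bottom to top, the integers within a box in increasing order. -/
def word (T : SVT cells) : List ℕ :=
  (List.range ((cells.sup fun c => max c.1 c.2) + 1)).flatMap fun j =>
    ((List.range ((cells.sup fun c => max c.1 c.2) + 1)).reverse).flatMap fun i =>
      (T.entry (i, j)).sort (· ≤ ·)

end SVT

/-- The stable Grothendieck polynomial of the shape given by `cells`, in the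
variables `x_1, …, x_m` (`0`-based: variables `0, …, m-1`):
`G(cells) = ∑_T (-1)^(|T| - #cells) x^T` over set-valued tableaux `T` of shape
`cells` with entries in `{1, …, m}`. -/
noncomputable def grothendieck (cells : Finset (ℕ × ℕ)) (m : ℕ) : MvPolynomial ℕ ℤ :=
  ∑ᶠ (T : SVT cells) (_ : T.Bounded m), ((-1 : ℤ) ^ (T.size - cells.card)) • T.monomial

/-- A reverse lattice word: every suffix contains, for each `i`, at least as
many occurrences of `i` as of `i + 1`. -/
def IsRLW (w : List ℕ) : Prop := ∀ s, s <:+ w → ∀ i, s.count (i + 1) ≤ s.count i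

/-- A partial reverse lattice word with respect to the (`0`-based, half-open)
interval `[a, b)`:  every suffix contains, for each `t` with `a ≤ t` and
`t + 1 < b`, at least as many occurrences of `t` as of `t + 1`. -/
def IsPartialRLW (a b : ℕ) (w : List ℕ) : Prop :=
  ∀ s, s <:+ w → ∀ t, a ≤ t → t + 1 < b → s.count (t + 1) ≤ s.count t

/-- `w` has content `ν`: the number of occurrences of `i` in `w` is the length
of the `i`-th row of `ν`. -/
def HasContent (w : List ℕ) (nu : YoungDiagram) : Prop := ∀ i, w.count i = nu.rowLen i

/-- The cells of the skew diagram `λ * μ`, obtained by placing `λ` and `μ`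
corner to corner: `λ` occupies rows `0, …, ℓ(λ)-1` shifted right by `μ₁`
columns, and `μ` occupies the rows below row `ℓ(λ)-1`. -/
def starCells (lam mu : YoungDiagram) : Finset (ℕ × ℕ) :=
  (lam.cells.image fun c => (c.1, c.2 + mu.rowLen 0)) ∪
    (mu.cells.image fun c => (c.1 + lam.colLen 0, c.2))

/-- The structure constant `c^ν_{λμ}`: `(-1)^(|ν|-|λ|-|μ|)` times the number of
set-valued tableaux of shape `λ * μ` whose word is a reverse lattice word with
content `ν`. -/
noncomputable def cLR (lam mu nu : YoungDiagram) : ℤ :=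
  (-1 : ℤ) ^ (nu.card - lam.card - mu.card) *
    (Nat.card {T : SVT (starCells lam mu) // IsRLW T.word ∧ HasContent T.word nu} : ℤ)

/-- The coproduct structure constant `d^ν_{λμ}`: `(-1)^(|λ|+|μ|-|ν|)` times the
number of set-valued tableaux of shape `ν` whose word is a partial reverse
lattice word with respect to both intervals `[1, ℓ(λ)]` and
`[ℓ(λ)+1, ℓ(λ)+ℓ(μ)]` and has content `(λ₁, …, λ_{ℓ(λ)}, μ₁, …, μ_{ℓ(μ)})`. -/
noncomputable def dCoeff (lam mu nu : YoungDiagram) : ℤ :=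
  (-1 : ℤ) ^ (lam.card + mu.card - nu.card) *
    (Nat.card {T : SVT nu.cells //
      IsPartialRLW 0 (lam.colLen 0) T.word ∧
      IsPartialRLW (lam.colLen 0) (lam.colLen 0 + mu.colLen 0) T.word ∧
      ∀ i, T.word.count i =
        if i < lam.colLen 0 then lam.rowLen i else mu.rowLen (i - lam.colLen 0)} : ℤ)

/-- The coefficient `α_{θ,μ}` for a shape `θ` given by `cells`:
`(-1)^(|μ|-|θ|)` times the number of set-valued tableaux of shape `θ` whose
word is a reverse lattice word with content `μ`. -/
noncomputable def alphaCoeff (cells : Finset (ℕ × ℕ)) (mu : YoungDiagram) : ℤ :=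
  (-1 : ℤ) ^ (mu.card - cells.card) *
    (Nat.card {T : SVT cells // IsRLW T.word ∧ HasContent T.word mu} : ℤ)

/-- `ν/λ` is a vertical strip: at most one box in each row. -/
def IsVerticalStrip (lam nu : YoungDiagram) : Prop := ∀ i, nu.rowLen i ≤ lam.rowLen i + 1

/-- `ν/λ` is a horizontal strip: at most one box in each column. -/
def IsHorizontalStrip (lam nu : YoungDiagram) : Prop := ∀ j, nu.colLen j ≤ lam.colLen j + 1

/-- A set of boxes is a rook strip if it has at most one box in each row and in
each column. -/
def IsRookStripCells (s : Finset (ℕ × ℕ)) : Prop :=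
  (∀ i, (s.filter fun c => c.1 = i).card ≤ 1) ∧ (∀ j, (s.filter fun c => c.2 = j).card ≤ 1)

/-- The rectangular Young diagram with `p` rows and `q` columns. -/
def rect (p q : ℕ) : YoungDiagram :=
  ⟨Finset.range p ×ˢ Finset.range q, by
    intro a b hba ha
    simp only [Finset.coe_product, Set.mem_prod, Finset.mem_coe, Finset.mem_range] at ha ⊢
    exact ⟨lt_of_le_of_lt hba.1 ha.1, lt_of_le_of_lt hba.2 ha.2⟩⟩

namespace SVT

variable {cells : Finset (ℕ × ℕ)}

theorem entry_injective : Function.Injective (entry : SVT cells → ℕ × ℕ → Finset ℕ) := by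
  rintro ⟨e, _⟩ ⟨e', _⟩ h
  cases h
  rfl

theorem mem_of_mem_entry (T : SVT cells) {c : ℕ × ℕ} {x : ℕ} (hx : x ∈ T.entry c) :
    c ∈ cells := by
  by_contra hc
  simp [T.eq_empty_of_not_mem c hc] at hx

theorem card_le_size (T : SVT cells) : cells.card ≤ T.size := by
  rw [Finset.card_eq_sum_ones]
  exact Finset.sum_le_sum fun c hc => (T.nonempty_of_mem c hc).card_pos

instance finite_bounded (m : ℕ) : Finite {T : SVT cells // T.Bounded m} := by
  refine Finite.of_injective
    (fun T (c : cells) => (⟨T.1.entry c, Finset.mem_powerset.2 fun x hx =>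
      Finset.mem_range.2 (T.2 c x hx)⟩ : (Finset.range m).powerset)) fun T T' h => ?_
  refine Subtype.ext (entry_injective (funext fun c => ?_))
  by_cases hc : c ∈ cells
  · exact congrArg Subtype.val (congrFun h ⟨c, hc⟩)
  · rw [T.1.eq_empty_of_not_mem c hc, T'.1.eq_empty_of_not_mem c hc]

/-- Going down `k` boxes in a column raises the entries by at least `k`. -/
theorem exists_add_le_of_mem (T : SVT cells) (j i k : ℕ)
    (hcol : ∀ r, i ≤ r → r ≤ i + k → (r, j) ∈ cells) {x : ℕ} (hx : x ∈ T.entry (i, j)) :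
    ∃ y ∈ T.entry (i + k, j), x + k ≤ y := by
  induction k with
  | zero => exact ⟨x, hx, le_rfl⟩
  | succ k ih =>
    obtain ⟨y, hy, hxy⟩ := ih fun r h₁ h₂ => hcol r h₁ (by omega)
    have hmem := hcol (i + k + 1) (by omega) (by omega)
    obtain ⟨z, hz⟩ := T.nonempty_of_mem _ hmem
    have := T.col_strict _ _ (T.mem_of_mem_entry hy) hmem y hy z hz
    exact ⟨z, hz, by omega⟩

/-- An entry `k` boxes below another box of its column is at least `k`. -/
theorem le_of_mem (T : SVT cells) (j i k : ℕ)
    (hcol : ∀ r, i ≤ r → r ≤ i + k → (r, j) ∈ cells) {x : ℕ} (hx : x ∈ T.entry (i + k, j)) :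
    k ≤ x := by
  induction k generalizing x with
  | zero => exact Nat.zero_le x
  | succ k ih =>
    have hmem := hcol (i + k) (by omega) (by omega)
    obtain ⟨y, hy⟩ := T.nonempty_of_mem _ hmem
    have := ih (fun r h₁ h₂ => hcol r h₁ (by omega)) hy
    have := T.col_strict _ _ hmem (T.mem_of_mem_entry hx) y hy x hx
    omega

/-- The restriction of a tableau to the boxes satisfying `P`. -/
def restrict (T : SVT cells) (P : ℕ × ℕ → Prop) [DecidablePred P] : SVT (cells.filter P) where
  entry c := if P c then T.entry c else ∅
  nonempty_of_mem c hc := by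
    rw [Finset.mem_filter] at hc
    rw [if_pos hc.2]
    exact T.nonempty_of_mem c hc.1
  eq_empty_of_not_mem c hc := by
    split_ifs with hP
    · exact T.eq_empty_of_not_mem c fun h => hc (Finset.mem_filter.2 ⟨h, hP⟩)
    · rfl
  row_weak i j h h' := by
    rw [Finset.mem_filter] at h h'
    rw [if_pos h.2, if_pos h'.2]
    exact T.row_weak i j h.1 h'.1
  col_strict i j h h' := by
    rw [Finset.mem_filter] at h h'
    rw [if_pos h.2, if_pos h'.2]
    exact T.col_strict i j h.1 h'.1

theorem Bounded.restrict {T : SVT cells} {m : ℕ} (hT : T.Bounded m) (P : ℕ × ℕ → Prop)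
    [DecidablePred P] : (T.restrict P).Bounded m := by
  intro c x hx
  simp only [SVT.restrict] at hx
  split_ifs at hx
  · exact hT c x hx
  · simp at hx

/-- Every entry of `T₁` in column `q - 1` is at most every entry of `T₂` in the box of column `q`
next to it. -/
def Compatible {q : ℕ} (T₁ : SVT (cells.filter fun c => c.2 < q))
    (T₂ : SVT (cells.filter fun c => q ≤ c.2)) : Prop :=
  ∀ i j, j + 1 = q → ∀ a ∈ T₁.entry (i, j), ∀ b ∈ T₂.entry (i, q), a ≤ b

/-- Two compatible tableaux on the two sides of a vertical line, glued together. -/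
def glue {q : ℕ} (T₁ : SVT (cells.filter fun c => c.2 < q))
    (T₂ : SVT (cells.filter fun c => q ≤ c.2)) (h : T₁.Compatible T₂) : SVT cells where
  entry c := if c.2 < q then T₁.entry c else T₂.entry c
  nonempty_of_mem c hc := by
    split_ifs with hq
    · exact T₁.nonempty_of_mem c (Finset.mem_filter.2 ⟨hc, hq⟩)
    · exact T₂.nonempty_of_mem c (Finset.mem_filter.2 ⟨hc, not_lt.1 hq⟩)
  eq_empty_of_not_mem c hc := by
    split_ifs
    · exact T₁.eq_empty_of_not_mem c fun h => hc (Finset.mem_filter.1 h).1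
    · exact T₂.eq_empty_of_not_mem c fun h => hc (Finset.mem_filter.1 h).1
  row_weak i j _ _ a ha b hb := by
    dsimp only at ha hb
    split_ifs at ha hb with h₁ h₂ h₂
    · exact T₁.row_weak i j (T₁.mem_of_mem_entry ha) (T₁.mem_of_mem_entry hb) a ha b hb
    · obtain rfl : j + 1 = q := by omega
      exact h i j rfl a ha b hb
    · omega
    · exact T₂.row_weak i j (T₂.mem_of_mem_entry ha) (T₂.mem_of_mem_entry hb) a ha b hb
  col_strict i j _ _ a ha b hb := by
    dsimp only at ha hb
    split_ifs at ha hb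
    · exact T₁.col_strict i j (T₁.mem_of_mem_entry ha) (T₁.mem_of_mem_entry hb) a ha b hb
    · exact T₂.col_strict i j (T₂.mem_of_mem_entry ha) (T₂.mem_of_mem_entry hb) a ha b hb

/-- If all pairs of bounded tableaux on the two sides of a vertical line are compatible, then
bounded tableaux correspond to such pairs. -/
def cutEquiv (q m : ℕ)
    (h : ∀ (T₁ : SVT (cells.filter fun c => c.2 < q)) (T₂ : SVT (cells.filter fun c => q ≤ c.2)),
      T₁.Bounded m → T₂.Bounded m → T₁.Compatible T₂) :
    {T : SVT cells // T.Bounded m} ≃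
      {T : SVT (cells.filter fun c => c.2 < q) // T.Bounded m} ×
        {T : SVT (cells.filter fun c => q ≤ c.2) // T.Bounded m} where
  toFun T := (⟨T.1.restrict _, T.2.restrict _⟩, ⟨T.1.restrict _, T.2.restrict _⟩)
  invFun T := ⟨glue T.1.1 T.2.1 (h _ _ T.1.2 T.2.2), by
    intro c x hx
    simp only [glue] at hx
    split_ifs at hx
    · exact T.1.2 c x hx
    · exact T.2.2 c x hx⟩
  left_inv T := by
    refine Subtype.ext (entry_injective (funext fun c => ?_))
    by_cases hc : c.2 < q
    · simp [glue, restrict, hc]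
    · simp [glue, restrict, hc, not_lt.1 hc]
  right_inv T := by
    refine Prod.ext (Subtype.ext (entry_injective (funext fun c => ?_)))
      (Subtype.ext (entry_injective (funext fun c => ?_)))
    · by_cases hc : c.2 < q
      · simp [glue, restrict, hc]
      · simp [restrict, hc, T.1.1.eq_empty_of_not_mem c]
    · by_cases hc : c.2 < q
      · simp [restrict, not_le.2 hc, T.2.1.eq_empty_of_not_mem c]
      · simp [glue, restrict, hc, not_lt.1 hc]

theorem size_restrict (T : SVT cells) (P : ℕ × ℕ → Prop) [DecidablePred P] :
    (T.restrict P).size = ∑ c ∈ cells.filter P, (T.entry c).card :=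
  Finset.sum_congr rfl fun c hc => by simp [restrict, (Finset.mem_filter.1 hc).2]

theorem monomial_restrict (T : SVT cells) (P : ℕ × ℕ → Prop) [DecidablePred P] :
    (T.restrict P).monomial = ∏ c ∈ cells.filter P, ∏ i ∈ T.entry c, X i :=
  Finset.prod_congr rfl fun c hc => by simp [restrict, (Finset.mem_filter.1 hc).2]

theorem size_restrict_add (T : SVT cells) (q : ℕ) :
    (T.restrict fun c => c.2 < q).size + (T.restrict fun c => q ≤ c.2).size = T.size := by
  simp only [size_restrict, ← not_lt]
  exact Finset.sum_filter_add_sum_filter_not ..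

theorem monomial_restrict_mul (T : SVT cells) (q : ℕ) :
    (T.restrict fun c => c.2 < q).monomial * (T.restrict fun c => q ≤ c.2).monomial =
      T.monomial := by
  simp only [monomial_restrict, ← not_lt]
  exact Finset.prod_filter_mul_prod_filter_not ..

end SVT

theorem grothendieck_eq_finsum_subtype (cells : Finset (ℕ × ℕ)) (m : ℕ) :
    grothendieck cells m = ∑ᶠ T : {T : SVT cells // T.Bounded m},
      ((-1 : ℤ) ^ (T.1.size - cells.card)) • T.1.monomial :=
  (finsum_subtype_eq_finsum_cond _).symm

/-- Stable Grothendieck polynomials factor along a vertical line whenever bounded tableaux on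
its two sides can always be glued. -/
theorem grothendieck_eq_mul_of_compatible (cells : Finset (ℕ × ℕ)) (q m : ℕ)
    (h : ∀ (T₁ : SVT (cells.filter fun c => c.2 < q)) (T₂ : SVT (cells.filter fun c => q ≤ c.2)),
      T₁.Bounded m → T₂.Bounded m → T₁.Compatible T₂) :
    grothendieck cells m =
      grothendieck (cells.filter fun c => c.2 < q) m *
        grothendieck (cells.filter fun c => q ≤ c.2) m := by
  have := fun s : Finset (ℕ × ℕ) => Fintype.ofFinite {T : SVT s // T.Bounded m}
  simp only [grothendieck_eq_finsum_subtype, finsum_eq_sum_of_fintype]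
  rw [Finset.sum_mul_sum, ← Fintype.sum_prod_type']
  refine Fintype.sum_equiv (SVT.cutEquiv q m h) _ _ fun T => ?_
  have hcard : (cells.filter fun c => c.2 < q).card + (cells.filter fun c => q ≤ c.2).card =
      cells.card := by
    simp only [← not_lt]
    exact Finset.card_filter_add_card_filter_not ..
  have hsize := T.1.size_restrict_add q
  have h₁ := (T.1.restrict fun c => c.2 < q).card_le_size
  have h₂ := (T.1.restrict fun c => q ≤ c.2).card_le_size
  simp only [SVT.cutEquiv, Equiv.coe_fn_mk]
  rw [smul_mul_smul_comm, T.1.monomial_restrict_mul, ← pow_add]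
  congr 2
  omega

/-- **Cutting a skew shape along a vertical line** (Lemma 6.2): if the skew
shape `θ = ν/λ` has a box in column `q` and a box in column `q + 1` (columns
`1`-based, i.e. `0`-based columns `q - 1` and `q`), `θ₁` consists of the boxes
of `θ` in columns `≤ q` and `θ₂` of the boxes in columns `> q`, and
`p = ν′_q - λ′_{q+1}`, then `G_θ(x_1,…,x_p) = G_{θ₁}(x_1,…,x_p) · G_{θ₂}(x_1,…,x_p)`. -/
theorem grothendieck_cut_vertical (lam nu : YoungDiagram) (h : lam ≤ nu) (q : ℕ)
    (hq : 1 ≤ q) (h1 : lam.colLen (q - 1) < nu.colLen (q - 1))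
    (h2 : lam.colLen q < nu.colLen q) :
    grothendieck (nu.cells \ lam.cells) (nu.colLen (q - 1) - lam.colLen q) =
      grothendieck ((nu.cells \ lam.cells).filter fun c => c.2 < q)
          (nu.colLen (q - 1) - lam.colLen q) *
        grothendieck ((nu.cells \ lam.cells).filter fun c => q ≤ c.2)
          (nu.colLen (q - 1) - lam.colLen q) := by
  refine grothendieck_eq_mul_of_compatible _ _ _ fun T₁ T₂ hT₁ _ i j hj a ha b hb => ?_
  subst hj
  rw [Nat.add_sub_cancel] at *
  have hi := T₁.mem_of_mem_entry ha
  have hi' := T₂.mem_of_mem_entry hb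
  simp only [Finset.mem_filter, Finset.mem_sdiff, YoungDiagram.mem_cells,
    YoungDiagram.mem_iff_lt_colLen, not_lt] at hi hi'
  obtain ⟨y, hy, hay⟩ := T₁.exists_add_le_of_mem j i (nu.colLen j - 1 - i) (fun r _ _ => by
    simp only [Finset.mem_filter, Finset.mem_sdiff, YoungDiagram.mem_cells,
      YoungDiagram.mem_iff_lt_colLen, not_lt]
    omega) ha
  have hym := hT₁ _ y hy
  have hlb := T₂.le_of_mem (j + 1) (lam.colLen (j + 1)) (i - lam.colLen (j + 1))
    (fun r _ _ => by
      simp only [Finset.mem_filter, Finset.mem_sdiff, YoungDiagram.mem_cells,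
        YoungDiagram.mem_iff_lt_colLen, not_lt]
      omega) (x := b) (by rwa [Nat.add_sub_cancel' hi'.1.2])
  omega
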